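/- Let (X,d) be a strongly geodesic δ-hyperbolic G-space with δ > 0 and let U ≤ G be a nontrivial subgroup. Then: (1) the sets X(U), E(U) and Z(U) are U-invariant, and if Λ(U) has at least two points then the weak convex hull X_U is U-invariant and 8δ-quasiconvex; moreover X(U) is connected, closed and 4δ-quasiconvex; (2) if p ∈ X, u ∈ U with u ≠ 1, and p' is a projection of p on X(U), then the concatenation of geodesic segments [p, p'], [p', up'], [up', up] is a (1, 100δ)-quasigeodesic. -/

import Mathlib

noncomputable section

namespace KW

open Metric Set Pointwise

variable {X : Type*} [MetricSpace X]

/-- `s` is (the image of) a unit-speed geodesic segment joining `x` to `y`. -/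
def IsGeodesicSegment (s : Set X) (x y : X) : Prop :=
  ∃ (b : ℝ) (f : ℝ → X), 0 ≤ b ∧ f 0 = x ∧ f b = y ∧
    (∀ u ∈ Set.Icc (0 : ℝ) b, ∀ v ∈ Set.Icc (0 : ℝ) b, dist (f u) (f v) = |u - v|) ∧
    s = f '' Set.Icc 0 b

/-- A geodesic metric space. -/
def GeodesicSpace (X : Type*) [MetricSpace X] : Prop :=
  ∀ x y : X, ∃ s : Set X, IsGeodesicSegment s x y

/-- `X` is `δ`-hyperbolic: geodesic, and every geodesic triangle is `δ`-thin. -/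
def DeltaHyperbolic (δ : ℝ) (X : Type*) [MetricSpace X] : Prop :=
  GeodesicSpace X ∧
    ∀ (x y z : X) (s₁ s₂ s₃ : Set X),
      IsGeodesicSegment s₁ x y → IsGeodesicSegment s₂ y z → IsGeodesicSegment s₃ x z →
      ∀ p ∈ s₁, ∃ q ∈ s₂ ∪ s₃, dist p q ≤ δ

/-- `A` is an `ε`-quasiconvex subset of `X`. -/
def Quasiconvex (ε : ℝ) (A : Set X) : Prop :=
  ∀ x ∈ A, ∀ y ∈ A, ∀ s : Set X, IsGeodesicSegment s x y → ∀ p ∈ s, ∃ a ∈ A, dist p a ≤ ε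

/-- The Gromov product `(y,z)_x`. -/
def gromov (x y z : X) : ℝ := (dist y x + dist z x - dist y z) / 2

def IsGeodesicRay (γ : ℝ → X) : Prop :=
  ∀ s t : ℝ, 0 ≤ s → 0 ≤ t → dist (γ s) (γ t) = |s - t|

def IsBiGeodesic (γ : ℝ → X) : Prop :=
  ∀ s t : ℝ, dist (γ s) (γ t) = |s - t|

/-- `A` and `B` are `K`-Hausdorff close. -/
def HClose (K : ℝ) (A B : Set X) : Prop :=
  (∀ a ∈ A, ∃ b ∈ B, dist a b ≤ K) ∧ ∀ b ∈ B, ∃ a ∈ A, dist a b ≤ K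

def HausdorffClose (A B : Set X) : Prop := ∃ K : ℝ, HClose K A B

/-- Two geodesic rays are asymptotic iff their images are Hausdorff close. -/
def Asymptotic (γ γ' : ℝ → X) : Prop :=
  HausdorffClose (γ '' Set.Ici 0) (γ' '' Set.Ici 0)

def GRay (X : Type*) [MetricSpace X] : Type _ := {γ : ℝ → X // IsGeodesicRay γ}

theorem asymptotic_refl (γ : ℝ → X) : Asymptotic γ γ :=
  ⟨0, fun a ha => ⟨a, ha, by simp⟩, fun b hb => ⟨b, hb, by simp⟩⟩

theorem asymptotic_symm {γ γ' : ℝ → X} (h : Asymptotic γ γ') : Asymptotic γ' γ := by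
  obtain ⟨K, h₁, h₂⟩ := h
  refine ⟨K, fun a ha => ?_, fun b hb => ?_⟩
  · obtain ⟨b, hb, hd⟩ := h₂ a ha
    exact ⟨b, hb, by rwa [dist_comm]⟩
  · obtain ⟨a, ha, hd⟩ := h₁ b hb
    exact ⟨a, ha, by rwa [dist_comm]⟩

theorem asymptotic_trans {γ₁ γ₂ γ₃ : ℝ → X} (h : Asymptotic γ₁ γ₂)
    (h' : Asymptotic γ₂ γ₃) : Asymptotic γ₁ γ₃ := by
  obtain ⟨K, h₁, h₂⟩ := h
  obtain ⟨K', h₁', h₂'⟩ := h'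
  refine ⟨K + K', fun a ha => ?_, fun c hc => ?_⟩
  · obtain ⟨b, hb, hab⟩ := h₁ a ha
    obtain ⟨c, hc, hbc⟩ := h₁' b hb
    exact ⟨c, hc, (dist_triangle a b c).trans (by linarith)⟩
  · obtain ⟨b, hb, hbc⟩ := h₂' c hc
    obtain ⟨a, ha, hab⟩ := h₂ b hb
    exact ⟨a, ha, (dist_triangle a b c).trans (by linarith)⟩

def raySetoid (X : Type*) [MetricSpace X] : Setoid (GRay X) where
  r γ γ' := Asymptotic γ.1 γ'.1
  iseqv := ⟨fun γ => asymptotic_refl γ.1, fun h => asymptotic_symm h,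
    fun h h' => asymptotic_trans h h'⟩

/-- The (geodesic) boundary of `X`: asymptoty classes of geodesic rays. -/
def Boundary (X : Type*) [MetricSpace X] : Type _ := Quotient (raySetoid X)

def Boundary.mk {X : Type*} [MetricSpace X] (γ : GRay X) : Boundary X :=
  Quotient.mk (raySetoid X) γ

/-- A strongly geodesic metric space. -/
def StronglyGeodesic (X : Type*) [MetricSpace X] : Prop :=
  GeodesicSpace X ∧
  (∀ γ : ℝ → X, IsGeodesicRay γ → ∀ y : X,
      ∃ γ' : ℝ → X, IsGeodesicRay γ' ∧ γ' 0 = y ∧ Asymptotic γ γ') ∧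
  (∀ γ₁ γ₂ : ℝ → X, IsGeodesicRay γ₁ → IsGeodesicRay γ₂ → γ₁ 0 = γ₂ 0 →
      ¬ Asymptotic γ₁ γ₂ →
      ∃ γ : ℝ → X, IsBiGeodesic γ ∧
        HausdorffClose (Set.range γ) (γ₁ '' Set.Ici 0 ∪ γ₂ '' Set.Ici 0)) ∧
  (∀ (x : X) (u : ℕ → X),
      (∀ M : ℝ, ∃ N : ℕ, ∀ n, N ≤ n → ∀ m, N ≤ m → M ≤ gromov x (u n) (u m)) →
      ∃ γ : ℝ → X, IsGeodesicRay γ ∧ γ 0 = x ∧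
        ∀ M : ℝ, ∃ N : ℕ, ∀ n, N ≤ n → ∀ m, N ≤ m → M ≤ gromov x (γ (n : ℝ)) (u m))

/-- The sequence `u` converges to the boundary point `p`, with basepoint `x`. -/
def SeqConvTo (x : X) (u : ℕ → X) (p : Boundary X) : Prop :=
  ∃ γ : GRay X, Boundary.mk γ = p ∧
    ∀ M : ℝ, ∃ N : ℕ, ∀ n, N ≤ n → ∀ m, N ≤ m → M ≤ gromov x (u n) (γ.1 (m : ℝ))

/-- `γ` is a geodesic ray in the class of the boundary point `p`. -/
def RayTo (γ : ℝ → X) (p : Boundary X) : Prop :=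
  ∃ h : IsGeodesicRay γ, Boundary.mk ⟨γ, h⟩ = p

/-- `γ` is a biinfinite geodesic whose two ends converge to `p` and `q`. -/
def BiGeodesicJoins (γ : ℝ → X) (p q : Boundary X) : Prop :=
  IsBiGeodesic γ ∧ SeqConvTo (γ 0) (fun n => γ (-(n : ℝ))) p ∧
    SeqConvTo (γ 0) (fun n => γ (n : ℝ)) q

/-- `s` is (the image of) a geodesic joining two points of `X ∪ ∂X`. -/
def JoinSet : X ⊕ Boundary X → X ⊕ Boundary X → Set X → Prop
  | Sum.inl x, Sum.inl y, s => IsGeodesicSegment s x y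
  | Sum.inl x, Sum.inr p, s => ∃ γ : ℝ → X, γ 0 = x ∧ RayTo γ p ∧ s = γ '' Set.Ici 0
  | Sum.inr p, Sum.inl x, s => ∃ γ : ℝ → X, γ 0 = x ∧ RayTo γ p ∧ s = γ '' Set.Ici 0
  | Sum.inr p, Sum.inr q, s => ∃ γ : ℝ → X, BiGeodesicJoins γ p q ∧ s = Set.range γ

/-- The convex hull `Conv(A)` of a subset `A ⊆ X ∪ ∂X`. -/
def geoConv (A : Set (X ⊕ Boundary X)) : Set X :=
  {x | (∃ a : X, A = {Sum.inl a} ∧ x = a) ∨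
    ∃ p ∈ A, ∃ q ∈ A, p ≠ q ∧ ∃ s : Set X, JoinSet p q s ∧ x ∈ s}

/-- The distance between two subsets of `X`. -/
def setDist (A B : Set X) : ℝ := sInf (Set.image2 dist A B)

/-- `a` is a projection of `p` on `A` (relative to `δ`). -/
def IsProjection (δ : ℝ) (A : Set X) (p a : X) : Prop :=
  a ∈ A ∧ ∀ a' ∈ A, dist p a ≤ dist p a' + δ

/-- `f` restricted to `[0,L]` is a unit-speed geodesic from `x` to `y`. -/
def GeodParam (f : ℝ → X) (L : ℝ) (x y : X) : Prop :=
  0 ≤ L ∧ f 0 = x ∧ f L = y ∧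
    ∀ u ∈ Set.Icc (0 : ℝ) L, ∀ v ∈ Set.Icc (0 : ℝ) L, dist (f u) (f v) = |u - v|

/-- Concatenation of three paths, the first on `[0,a]`, the second on `[0,b]`. -/
def concat3 (f₁ f₂ f₃ : ℝ → X) (a b : ℝ) : ℝ → X := fun t =>
  if t ≤ a then f₁ t else if t ≤ a + b then f₂ (t - a) else f₃ (t - a - b)

/-- `f` is a `(lam, ε)`-quasigeodesic on `[a,b]`. -/
def QuasigeodesicOn (lam ε : ℝ) (f : ℝ → X) (a b : ℝ) : Prop :=
  ∀ s ∈ Set.Icc a b, ∀ t ∈ Set.Icc a b, |s - t| ≤ lam * dist (f s) (f t) + ε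

/-- The action of `G` on `X` is by isometries. -/
def IsometricAction (G Y : Type*) [Group G] [MetricSpace Y] [MulAction G Y] : Prop :=
  ∀ (g : G) (x y : Y), dist (g • x) (g • y) = dist x y

section GroupAction

variable {G : Type*} [Group G]

/-- The limit set `Λ(U) ⊆ ∂X` of a subgroup `U ≤ G`. -/
def limitSet (X : Type*) [MetricSpace X] [MulAction G X] (U : Subgroup G) :
    Set (Boundary X) :=
  {p | ∃ x₀ : X, ∃ u : ℕ → U, SeqConvTo x₀ (fun n => ((u n : G)) • x₀) p}

/-- The small displacement set `E(U)` (relative to `δ`). -/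
def smallDispSet (X : Type*) [MetricSpace X] [MulAction G X] (δ : ℝ) (U : Subgroup G) :
    Set X :=
  {x | ∃ u : G, u ∈ U ∧ u ≠ 1 ∧ dist x (u • x) ≤ 100 * δ}

/-- `Z(U) = Conv(Λ(U) ∪ E(U))`. -/
def ZSet (X : Type*) [MetricSpace X] [MulAction G X] (δ : ℝ) (U : Subgroup G) : Set X :=
  geoConv (Sum.inr '' limitSet X U ∪ Sum.inl '' smallDispSet X δ U)

/-- The convex hull `X(U)`: the closure of `Conv(Z(U))`. -/
def cHull (X : Type*) [MetricSpace X] [MulAction G X] (δ : ℝ) (U : Subgroup G) : Set X :=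
  closure (geoConv (Sum.inl '' ZSet X δ U))

/-- The weak convex hull `X_U = Conv(Λ(U))`. -/
def weakHull (X : Type*) [MetricSpace X] [MulAction G X] (U : Subgroup G) : Set X :=
  geoConv (Sum.inr '' limitSet X U)

/-- `l_V(g) = d(X(V), gX(V))`. -/
def lV (X : Type*) [MetricSpace X] [MulAction G X] (δ : ℝ) (V : Subgroup G) (g : G) : ℝ :=
  setDist (cHull X δ V) (g • cHull X δ V)

/-- The translation length of `g`. -/
def translationLength (X : Type*) [MetricSpace X] [MulAction G X] (g : G) : ℝ :=
  sInf (Set.range fun x : X => dist x (g • x))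

/-- The asymptotic translation length of `g`. -/
def asympTranslationLength (X : Type*) [MetricSpace X] [MulAction G X] (g : G) : ℝ :=
  Filter.liminf (fun n : ℕ => translationLength X (g ^ n) / (n : ℝ)) Filter.atTop

/-- An elementary move between `G`-tuples `(U₁,…,U_n; h₁,…,h_m)`. -/
def gMove {n m : ℕ} (M M' : (Fin n → Subgroup G) × (Fin m → G)) : Prop :=
  (M'.2 = M.2 ∧ ∃ (j : Fin n) (g : G),
      g ∈ Subgroup.closure (Set.range M.2 ∪ ⋃ i ∈ {i : Fin n | i ≠ j}, ((M.1 i : Set G))) ∧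
      (∀ i, i ≠ j → M'.1 i = M.1 i) ∧
      M'.1 j = Subgroup.map (MulAut.conj g).toMonoidHom (M.1 j)) ∨
  (M'.1 = M.1 ∧ ∃ (i : Fin m) (g₁ g₂ : G),
      g₁ ∈ Subgroup.closure (M.2 '' {j : Fin m | j ≠ i} ∪ ⋃ t, ((M.1 t : Set G))) ∧
      g₂ ∈ Subgroup.closure (M.2 '' {j : Fin m | j ≠ i} ∪ ⋃ t, ((M.1 t : Set G))) ∧
      (∀ j, j ≠ i → M'.2 j = M.2 j) ∧
      M'.2 i = g₁ * M.2 i * g₂)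

/-- Equivalence of `G`-tuples: a finite chain of elementary moves. -/
def gEquiv {n m : ℕ} :
    (Fin n → Subgroup G) × (Fin m → G) → (Fin n → Subgroup G) × (Fin m → G) → Prop :=
  Relation.ReflTransGen gMove

/-- The family of factors `U₁,…,U_n, F(h₁),…,F(h_m)`. -/
def FF {n : ℕ} (m : ℕ) (U : Fin n → Subgroup G) : Fin n ⊕ Fin m → Type _
  | Sum.inl j => ↥(U j)
  | Sum.inr _ => FreeGroup PUnit

instance ffGroup {n : ℕ} (m : ℕ) (U : Fin n → Subgroup G) :
    (i : Fin n ⊕ Fin m) → Group (FF m U i)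
  | Sum.inl j => inferInstanceAs (Group ↥(U j))
  | Sum.inr _ => inferInstanceAs (Group (FreeGroup PUnit))

def ffHoms {n m : ℕ} (U : Fin n → Subgroup G) (H : Fin m → G) :
    (i : Fin n ⊕ Fin m) → FF m U i →* G
  | Sum.inl j => (U j).subtype
  | Sum.inr j => FreeGroup.lift fun _ => H j

/-- The canonical homomorphism `U₁ ∗ ⋯ ∗ U_n ∗ F(H) → G`. -/
def freeProdHom {n m : ℕ} (U : Fin n → Subgroup G) (H : Fin m → G) :
    Monoid.CoprodI (FF m U) →* G :=
  Monoid.CoprodI.lift (ffHoms U H)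

/-- `W = U₁ ∗ ⋯ ∗ U_n ∗ F(H)`: the canonical homomorphism is injective with image `W`. -/
def IsFreeProdDecomp {n m : ℕ} (U : Fin n → Subgroup G) (H : Fin m → G)
    (W : Subgroup G) : Prop :=
  Function.Injective (freeProdHom U H) ∧ (freeProdHom U H).range = W

/-- Minimality of the `G`-pair `(V; H)` (relative to a `1`-hyperbolic `G`-space `X`). -/
def PairMinimal (X : Type*) [MetricSpace X] [MulAction G X] {m : ℕ}
    (V : Subgroup G) (H : Fin m → G) : Prop :=
  ∀ (V' : Subgroup G) (H' : Fin m → G),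
    gEquiv ((fun _ : Fin 1 => V), H) ((fun _ : Fin 1 => V'), H') →
    (∑ i, lV X 1 V (H i)) ≤ (∑ i, lV X 1 V' (H' i)) + 1

/-- An elementary Nielsen move on tuples of elements of `G`. -/
def NielsenMove {k : ℕ} (g g' : Fin k → G) : Prop :=
  (∃ i : Fin k, (∀ j, j ≠ i → g' j = g j) ∧ g' i = (g i)⁻¹) ∨
  (∃ i j : Fin k, i ≠ j ∧ (∀ t, t ≠ i → g' t = g t) ∧ g' i = g i * g j) ∨
  (∃ i j : Fin k, i ≠ j ∧ g' = g ∘ Equiv.swap i j)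

/-- Nielsen equivalence: a finite chain of elementary Nielsen moves. -/
def NielsenEq {k : ℕ} : (Fin k → G) → (Fin k → G) → Prop :=
  Relation.ReflTransGen NielsenMove

/-- Word length of `g` with respect to the (symmetrized) generating set `S`. -/
def wordLength (S : Set G) (g : G) : ℕ :=
  sInf {n : ℕ | ∃ f : Fin n → G, (∀ i, f i ∈ S ∨ (f i)⁻¹ ∈ S) ∧ (List.ofFn f).prod = g}

/-- `(X, ι)` is a model of the Cayley graph `Γ(G,S)`. -/
def IsCayleyGraph (G : Type*) [Group G] (S : Set G) (X : Type*) [MetricSpace X]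
    [MulAction G X] (ι : G → X) : Prop :=
  IsometricAction G X ∧
  (∀ g h : G, ι (g * h) = g • ι h) ∧
  Function.Injective ι ∧
  GeodesicSpace X ∧
  (∀ g h : G, dist (ι g) (ι h) = (wordLength S (g⁻¹ * h) : ℝ)) ∧
  ∀ x : X, ∃ g h : G, wordLength S (g⁻¹ * h) ≤ 1 ∧
    ∃ s : Set X, IsGeodesicSegment s (ι g) (ι h) ∧ x ∈ s

/-- `H` is a quasiconvex subgroup (with respect to the Cayley graph model `(X, ι)`). -/
def QCSubgroup (X : Type*) [MetricSpace X] (ι : G → X) (H : Subgroup G) : Prop :=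
  ∃ ε : ℝ, 0 ≤ ε ∧ Quasiconvex ε (ι '' (H : Set G))

end GroupAction

/-- Every nontrivial element of finite order has finite centralizer. -/
def AlmostTorsionFree (G : Type*) [Group G] : Prop :=
  ∀ g : G, g ≠ 1 → IsOfFinOrder g → ((Subgroup.centralizer {g} : Subgroup G) : Set G).Finite

/-- `U` is nontrivial and admits no nontrivial free product decomposition. -/
def FreelyIndecomposable (U : Type*) [Group U] : Prop :=
  Nontrivial U ∧
    ¬ ∃ A B : Subgroup U, A ≠ ⊥ ∧ B ≠ ⊥ ∧
        Function.Bijective (Monoid.Coprod.lift A.subtype B.subtype)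

def InfiniteCyclic (U : Type*) [Group U] : Prop := Infinite U ∧ IsCyclic U

def VirtuallyCyclic (U : Type*) [Group U] : Prop :=
  ∃ H : Subgroup U, H.index ≠ 0 ∧ IsCyclic ↥H

def NonElementary (U : Type*) [Group U] : Prop := ¬ Finite U ∧ ¬ VirtuallyCyclic U

end KW

universe u v

namespace KW

open Pointwise Metric Set

section Helpers

variable {X : Type v} [MetricSpace X]

theorem seg_of_isom {f : ℝ → X} {a b : ℝ} (hab : a ≤ b)
    (h : ∀ u ∈ Set.Icc a b, ∀ v ∈ Set.Icc a b, dist (f u) (f v) = |u - v|) :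
    IsGeodesicSegment (f '' Set.Icc a b) (f a) (f b) := by
  refine ⟨b - a, fun t => f (a + t), by linarith, by simp, by simp, ?_, ?_⟩
  · intro u hu v hv
    rw [h _ ⟨by linarith [hu.1], by linarith [hu.2]⟩ _ ⟨by linarith [hv.1], by linarith [hv.2]⟩]
    congr 1; ring
  · ext x
    constructor
    · rintro ⟨t, ht, rfl⟩
      exact ⟨t - a, ⟨by linarith [ht.1], by linarith [ht.2]⟩, by simp⟩
    · rintro ⟨t, ht, rfl⟩
      exact ⟨a + t, ⟨by linarith [ht.1], by linarith [ht.2]⟩, rfl⟩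

theorem seg_left {s : Set X} {x y : X} (h : IsGeodesicSegment s x y) : x ∈ s := by
  obtain ⟨b, f, hb, h0, h1, -, rfl⟩ := h
  exact ⟨0, ⟨le_rfl, hb⟩, h0⟩

theorem seg_right {s : Set X} {x y : X} (h : IsGeodesicSegment s x y) : y ∈ s := by
  obtain ⟨b, f, hb, h0, h1, -, rfl⟩ := h
  exact ⟨b, ⟨hb, le_rfl⟩, h1⟩

theorem seg_symm {s : Set X} {x y : X} (h : IsGeodesicSegment s x y) :
    IsGeodesicSegment s y x := by
  obtain ⟨b, f, hb, h0, h1, hf, rfl⟩ := h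
  refine ⟨b, fun t => f (b - t), hb, by simpa using h1, by simpa using h0, ?_, ?_⟩
  · intro u hu v hv
    rw [hf _ ⟨by linarith [hu.2], by linarith [hu.1]⟩ _ ⟨by linarith [hv.2], by linarith [hv.1]⟩,
      abs_sub_comm]
    congr 1; ring
  · ext x
    constructor
    · rintro ⟨t, ht, rfl⟩
      exact ⟨b - t, ⟨by linarith [ht.2], by linarith [ht.1]⟩, by simp⟩
    · rintro ⟨t, ht, rfl⟩
      exact ⟨b - t, ⟨by linarith [ht.2], by linarith [ht.1]⟩, rfl⟩

theorem seg_sub {s : Set X} {x y p : X} (h : IsGeodesicSegment s x y) (hp : p ∈ s) :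
    ∃ s' ⊆ s, IsGeodesicSegment s' x p := by
  obtain ⟨b, f, hb, h0, h1, hf, rfl⟩ := h
  obtain ⟨t, ht, rfl⟩ := hp
  refine ⟨f '' Set.Icc 0 t, Set.image_mono (Set.Icc_subset_Icc le_rfl ht.2), ?_⟩
  have := seg_of_isom (f := f) ht.1 (fun u hu v hv => hf u ⟨hu.1, hu.2.trans ht.2⟩ v
    ⟨hv.1, hv.2.trans ht.2⟩)
  rwa [h0] at this

theorem seg_dist {s : Set X} {x y p : X} (h : IsGeodesicSegment s x y) (hp : p ∈ s) :
    dist x p + dist p y = dist x y := by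
  obtain ⟨b, f, hb, h0, h1, hf, rfl⟩ := h
  obtain ⟨t, ht, rfl⟩ := hp
  rw [← h0, ← h1, hf 0 ⟨le_rfl, hb⟩ t ht, hf t ht b ⟨hb, le_rfl⟩, hf 0 ⟨le_rfl, hb⟩ b ⟨hb, le_rfl⟩,
    abs_of_nonpos (by linarith [ht.1]), abs_of_nonpos (by linarith [ht.2]),
    abs_of_nonpos (by linarith)]
  ring

theorem seg_point {s : Set X} {x y : X} (h : IsGeodesicSegment s x y) {t : ℝ} (h0t : 0 ≤ t)
    (ht : t ≤ dist x y) : ∃ p ∈ s, dist x p = t := by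
  obtain ⟨b, f, hb, h0, h1, hf, rfl⟩ := h
  have hd : dist x y = b := by
    rw [← h0, ← h1, hf 0 ⟨le_rfl, hb⟩ b ⟨hb, le_rfl⟩, abs_of_nonpos (by linarith)]; ring
  refine ⟨f t, ⟨t, ⟨h0t, hd ▸ ht⟩, rfl⟩, ?_⟩
  rw [← h0, hf 0 ⟨le_rfl, hb⟩ t ⟨h0t, hd ▸ ht⟩, abs_of_nonpos (by linarith)]; ring

theorem isom_contOn {f : ℝ → X} {b : ℝ}
    (hf : ∀ u ∈ Set.Icc 0 b, ∀ v ∈ Set.Icc 0 b, dist (f u) (f v) = |u - v|) :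
    ContinuousOn f (Set.Icc 0 b) := by
  have : LipschitzOnWith 1 f (Set.Icc 0 b) := by
    apply LipschitzOnWith.of_dist_le_mul
    intro u hu v hv
    rw [hf u hu v hv, Real.dist_eq]; simp
  exact this.continuousOn

theorem seg_preconn {s : Set X} {x y : X} (h : IsGeodesicSegment s x y) : IsPreconnected s := by
  obtain ⟨b, f, hb, h0, h1, hf, rfl⟩ := h
  exact isPreconnected_Icc.image f (isom_contOn hf)

theorem seg_compact {s : Set X} {x y : X} (h : IsGeodesicSegment s x y) : IsCompact s := by
  obtain ⟨b, f, hb, h0, h1, hf, rfl⟩ := h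
  exact isCompact_Icc.image_of_continuousOn (isom_contOn hf)

theorem triC {δ : ℝ} (H : DeltaHyperbolic δ X) {x y w z : X} {s s₁ s₂ : Set X}
    (h : IsGeodesicSegment s x y) (h₁ : IsGeodesicSegment s₁ x w)
    (h₂ : IsGeodesicSegment s₂ w y) (hz : z ∈ s) :
    (∃ q ∈ s₁, dist z q ≤ δ) ∨ ∃ q ∈ s₂, dist z q ≤ δ := by
  obtain ⟨q, hq, hd⟩ := H.2 x y w s s₂ s₁ h (seg_symm h₂) h₁ z hz
  rcases hq with hq | hq
  · exact Or.inr ⟨q, hq, hd⟩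
  · exact Or.inl ⟨q, hq, hd⟩

/-- A quadrilateral is `2δ`-thin. -/
theorem quadC {δ : ℝ} (H : DeltaHyperbolic δ X) {x y w w' z : X} {s s₁ s₂ s₃ : Set X}
    (h : IsGeodesicSegment s x y) (h₁ : IsGeodesicSegment s₁ x w)
    (h₂ : IsGeodesicSegment s₂ w w') (h₃ : IsGeodesicSegment s₃ w' y) (hz : z ∈ s) :
    (∃ q ∈ s₁, dist z q ≤ 2 * δ) ∨ (∃ q ∈ s₂, dist z q ≤ 2 * δ) ∨
      ∃ q ∈ s₃, dist z q ≤ 2 * δ := by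
  obtain ⟨t, ht⟩ := H.1 w y
  rcases triC H h h₁ ht hz with ⟨q, hq, hd⟩ | ⟨q, hq, hd⟩
  · exact Or.inl ⟨q, hq, by linarith [dist_nonneg (x := z) (y := q)]⟩
  · rcases triC H ht h₂ h₃ hq with ⟨r, hr, hd'⟩ | ⟨r, hr, hd'⟩
    · exact Or.inr (Or.inl ⟨r, hr, by linarith [dist_triangle z q r]⟩)
    · exact Or.inr (Or.inr ⟨r, hr, by linarith [dist_triangle z q r]⟩)

/-- There is a point of the side `[x,y]` close to both other sides. -/
theorem tri_center {δ : ℝ} (hδ : 0 < δ) (H : DeltaHyperbolic δ X) {x y w : X} {s s₁ s₂ : Set X}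
    (h : IsGeodesicSegment s x y) (h₁ : IsGeodesicSegment s₁ x w)
    (h₂ : IsGeodesicSegment s₂ w y) :
    ∃ z ∈ s, (∃ q ∈ s₁, dist z q ≤ δ) ∧ ∃ q ∈ s₂, dist z q ≤ δ := by
  have key : ∀ t : Set X, IsCompact t → ∀ z, z ∈ cthickening δ t ↔ ∃ q ∈ t, dist z q ≤ δ := by
    intro t ht z
    rw [ht.cthickening_eq_biUnion_closedBall hδ.le]
    simp [mem_closedBall]
  have hp := isPreconnected_closed_iff.1 (seg_preconn h) (cthickening δ s₁) (cthickening δ s₂)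
    isClosed_cthickening isClosed_cthickening
    (by
      intro z hz
      rcases triC H h h₁ h₂ hz with h' | h'
      · exact Or.inl ((key _ (seg_compact h₁) z).2 h')
      · exact Or.inr ((key _ (seg_compact h₂) z).2 h'))
    ⟨x, seg_left h, (key _ (seg_compact h₁) x).2 ⟨x, seg_left h₁, by simpa using hδ.le⟩⟩
    ⟨y, seg_right h, (key _ (seg_compact h₂) y).2 ⟨y, seg_right h₂, by simpa using hδ.le⟩⟩
  obtain ⟨z, hz, hz1, hz2⟩ := hp
  exact ⟨z, hz, (key _ (seg_compact h₁) z).1 hz1, (key _ (seg_compact h₂) z).1 hz2⟩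

/-! ### Projections -/

theorem proj_sub {δ : ℝ} {A : Set X} {p a z : X} {s : Set X} (h : IsProjection δ A p a)
    (hs : IsGeodesicSegment s p a) (hz : z ∈ s) : IsProjection δ A z a := by
  refine ⟨h.1, fun y hy => ?_⟩
  have h1 := h.2 y hy
  have h2 := seg_dist hs hz
  linarith [dist_triangle p z y]

theorem proj_dist {δ : ℝ} (hδ : 0 < δ) (H : DeltaHyperbolic δ X) {A : Set X}
    (hA : Quasiconvex (4 * δ) A) {p a b : X} (h : IsProjection δ A p a) (hb : b ∈ A) :
    dist p a + dist a b - 16 * δ ≤ dist p b := by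
  obtain ⟨s, hs⟩ := H.1 p b
  obtain ⟨s₁, hs₁⟩ := H.1 p a
  obtain ⟨s₂, hs₂⟩ := H.1 a b
  obtain ⟨w, hw, ⟨x, hx, hwx⟩, ⟨v, hv, hwv⟩⟩ := tri_center hδ H hs hs₁ hs₂
  obtain ⟨y, hy, hvy⟩ := hA a h.1 b hb s₂ hs₂ v hv
  have h1 := (proj_sub h hs₁ hx).2 y hy
  have h2 : dist x y ≤ 6 * δ := by
    have := dist_triangle x w v
    have := dist_triangle x v y
    rw [dist_comm w x] at hwx
    linarith
  have h3 : dist w a ≤ 8 * δ := by linarith [dist_triangle w x a]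
  have h4 := seg_dist hs hw
  have h5 := dist_triangle p w a
  have h6 := dist_triangle a w b
  rw [dist_comm a w] at h6
  linarith

theorem proj_two {δ : ℝ} (hδ : 0 < δ) (H : DeltaHyperbolic δ X) {A : Set X}
    (hA : Quasiconvex (4 * δ) A) {p a q b : X} (h : IsProjection δ A p a)
    (h' : IsProjection δ A q b) (hab : 20 * δ ≤ dist a b) :
    dist p a + dist a b + dist b q - 34 * δ ≤ dist p q := by
  obtain ⟨s, hs⟩ := H.1 p q
  obtain ⟨t, ht⟩ := H.1 p b
  obtain ⟨t', ht'⟩ := H.1 b q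
  obtain ⟨r, hr⟩ := H.1 p a
  obtain ⟨m, hm⟩ := H.1 a b
  obtain ⟨w, hw, ⟨v, hv, hwv⟩, ⟨x, hx, hwx⟩⟩ := tri_center hδ H hs ht ht'
  have hxp := proj_sub h' (seg_symm ht') hx
  have hpb := proj_dist hδ H hA h h'.1
  rcases triC H ht hr hm hv with ⟨z, hz, hvz⟩ | ⟨z, hz, hvz⟩
  · exfalso
    have hzp := proj_sub h hr hz
    have h1 := proj_dist hδ H hA hzp h'.1
    have h2 := proj_dist hδ H hA hxp h.1
    have h3 : dist x z ≤ 3 * δ := by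
      have := dist_triangle x w v
      have := dist_triangle x v z
      rw [dist_comm w x] at hwx
      linarith
    have h4 := dist_triangle z x b
    have h5 := dist_triangle x z a
    rw [dist_comm z x] at h4
    rw [dist_comm b a] at h2
    linarith
  · obtain ⟨y, hy, hzy⟩ := hA a h.1 b h'.1 m hm z hz
    have h1 := hxp.2 y hy
    have h3 : dist x y ≤ 7 * δ := by
      have := dist_triangle x w v
      have := dist_triangle x v z
      have := dist_triangle x z y
      rw [dist_comm w x] at hwx
      linarith
    have h4 := dist_triangle w x b
    have h5 := seg_dist hs hw
    have h6 := dist_triangle p w b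
    have h7 := dist_triangle b w q
    rw [dist_comm b w] at h7
    linarith

/-! ### Concatenations -/

theorem concat3_lip {f₁ f₂ f₃ : ℝ → X} {a b c : ℝ} {x y z w : X}
    (h₁ : GeodParam f₁ a x y) (h₂ : GeodParam f₂ b y z) (h₃ : GeodParam f₃ c z w) :
    ∀ s ∈ Set.Icc 0 (a + b + c), ∀ t ∈ Set.Icc 0 (a + b + c), s ≤ t →
      dist (concat3 f₁ f₂ f₃ a b s) (concat3 f₁ f₂ f₃ a b t) ≤ t - s := by
  obtain ⟨ha, h10, h11, h1⟩ := h₁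
  obtain ⟨hb, h20, h21, h2⟩ := h₂
  obtain ⟨hc, h30, h31, h3⟩ := h₃
  have k1 : ∀ u v, 0 ≤ u → u ≤ v → v ≤ a → dist (f₁ u) (f₁ v) = v - u := fun u v hu huv hv => by
    rw [h1 u ⟨hu, huv.trans hv⟩ v ⟨hu.trans huv, hv⟩, abs_of_nonpos (by linarith)]; ring
  have k2 : ∀ u v, 0 ≤ u → u ≤ v → v ≤ b → dist (f₂ u) (f₂ v) = v - u := fun u v hu huv hv => by
    rw [h2 u ⟨hu, huv.trans hv⟩ v ⟨hu.trans huv, hv⟩, abs_of_nonpos (by linarith)]; ring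
  have k3 : ∀ u v, 0 ≤ u → u ≤ v → v ≤ c → dist (f₃ u) (f₃ v) = v - u := fun u v hu huv hv => by
    rw [h3 u ⟨hu, huv.trans hv⟩ v ⟨hu.trans huv, hv⟩, abs_of_nonpos (by linarith)]; ring
  intro s hs t ht hst
  have hs0 := hs.1
  have ht1 := ht.2
  unfold concat3
  by_cases c1 : s ≤ a
  · by_cases d1 : t ≤ a
    · rw [if_pos c1, if_pos d1, k1 s t hs0 hst d1]
    · push Not at d1
      have e1 := k1 s a hs0 c1 le_rfl
      rw [h11] at e1
      by_cases d2 : t ≤ a + b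
      · rw [if_pos c1, if_neg (not_le.2 d1), if_pos d2]
        have e2 := k2 0 (t - a) le_rfl (by linarith) (by linarith)
        rw [h20] at e2
        linarith [dist_triangle (f₁ s) y (f₂ (t - a))]
      · push Not at d2
        rw [if_pos c1, if_neg (not_le.2 d1), if_neg (not_le.2 d2)]
        have e2 := k2 0 b le_rfl hb le_rfl
        rw [h20, h21] at e2
        have e3 := k3 0 (t - a - b) le_rfl (by linarith) (by linarith)
        rw [h30] at e3
        linarith [dist_triangle (f₁ s) y (f₃ (t - a - b)), dist_triangle y z (f₃ (t - a - b))]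
  · push Not at c1
    have d1 : a < t := by linarith
    rw [if_neg (not_le.2 c1), if_neg (not_le.2 d1)]
    by_cases c2 : s ≤ a + b
    · rw [if_pos c2]
      by_cases d2 : t ≤ a + b
      · rw [if_pos d2, k2 (s - a) (t - a) (by linarith) (by linarith) (by linarith)]
        linarith
      · push Not at d2
        rw [if_neg (not_le.2 d2)]
        have e2 := k2 (s - a) b (by linarith) (by linarith) le_rfl
        rw [h21] at e2
        have e3 := k3 0 (t - a - b) le_rfl (by linarith) (by linarith)
        rw [h30] at e3
        linarith [dist_triangle (f₂ (s - a)) z (f₃ (t - a - b))]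
    · push Not at c2
      have d2 : a + b < t := by linarith
      rw [if_neg (not_le.2 c2), if_neg (not_le.2 d2),
        k3 (s - a - b) (t - a - b) (by linarith) (by linarith) (by linarith)]
      linarith

theorem concat3_qg {f₁ f₂ f₃ : ℝ → X} {a b c ε : ℝ} {x y z w : X}
    (h₁ : GeodParam f₁ a x y) (h₂ : GeodParam f₂ b y z) (h₃ : GeodParam f₃ c z w)
    (hd : a + b + c - ε ≤ dist x w) :
    QuasigeodesicOn 1 ε (concat3 f₁ f₂ f₃ a b) 0 (a + b + c) := by
  have L := concat3_lip h₁ h₂ h₃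
  obtain ⟨ha, h10, h11, h1⟩ := h₁
  obtain ⟨hb, h20, h21, h2⟩ := h₂
  obtain ⟨hc, h30, h31, h3⟩ := h₃
  have e0 : concat3 f₁ f₂ f₃ a b 0 = x := by simp [concat3, ha, h10]
  have e1 : concat3 f₁ f₂ f₃ a b (a + b + c) = w := by
    unfold concat3
    split_ifs with i1 i2
    · have hb0 : b = 0 := by linarith
      have hc0 : c = 0 := by linarith
      subst hb0 hc0
      rw [add_zero, add_zero, h11, ← h31, h30, ← h21, h20]
    · have hc0 : c = 0 := by linarith
      subst hc0
      rw [show a + b + 0 - a = b by ring, h21, ← h31, h30]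
    · rw [show a + b + c - a - b = c by ring, h31]
  have main : ∀ s ∈ Set.Icc 0 (a + b + c), ∀ t ∈ Set.Icc 0 (a + b + c), s ≤ t →
      t - s ≤ dist (concat3 f₁ f₂ f₃ a b s) (concat3 f₁ f₂ f₃ a b t) + ε := by
    intro s hs t ht hst
    have l1 := L 0 ⟨le_rfl, by linarith⟩ s hs hs.1
    have l2 := L t ht (a + b + c) ⟨by linarith, le_rfl⟩ ht.2
    rw [e0] at l1
    rw [e1] at l2
    have := dist_triangle x (concat3 f₁ f₂ f₃ a b s) w
    have := dist_triangle (concat3 f₁ f₂ f₃ a b s) (concat3 f₁ f₂ f₃ a b t) w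
    linarith
  intro s hs t ht
  rcases le_total s t with h | h
  · rw [abs_of_nonpos (by linarith)]
    linarith [main s hs t ht h]
  · rw [abs_of_nonneg (by linarith), dist_comm]
    linarith [main t ht s hs h]

/-! ### Hulls of subsets of `X` -/

theorem mem_conv_self {A : Set X} (H : GeodesicSpace X) {a : X} (ha : a ∈ A) :
    a ∈ geoConv (X := X) (Sum.inl '' A) := by
  by_cases h : ∃ b ∈ A, b ≠ a
  · obtain ⟨b, hb, hne⟩ := h
    obtain ⟨s, hs⟩ := H a b
    exact Or.inr ⟨Sum.inl a, ⟨a, ha, rfl⟩, Sum.inl b, ⟨b, hb, rfl⟩,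
      fun h => hne (Sum.inl_injective h).symm, s, hs, seg_left hs⟩
  · push Not at h
    refine Or.inl ⟨a, ?_, rfl⟩
    have : A = {a} := by
      ext x; constructor
      · intro hx; exact h x hx
      · rintro rfl; exact ha
    rw [this, Set.image_singleton]

theorem seg_self {s : Set X} {x : X} (h : IsGeodesicSegment s x x) : s ⊆ {x} := by
  intro p hp
  have := seg_dist h hp
  rw [dist_self, dist_comm x p] at this
  exact dist_le_zero.1 (by linarith)

theorem seg_sub_conv {A : Set X} (H : GeodesicSpace X) {a b : X} (ha : a ∈ A) (hb : b ∈ A)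
    {s : Set X} (hs : IsGeodesicSegment s a b) : s ⊆ geoConv (X := X) (Sum.inl '' A) := by
  by_cases h : a = b
  · subst h
    intro p hp
    rw [seg_self hs hp]
    exact mem_conv_self H ha
  · intro p hp
    exact Or.inr ⟨Sum.inl a, ⟨a, ha, rfl⟩, Sum.inl b, ⟨b, hb, rfl⟩,
      fun h' => h (Sum.inl_injective h'), s, hs, hp⟩

theorem conv_elim {A : Set X} (H : GeodesicSpace X) {x : X}
    (hx : x ∈ geoConv (X := X) (Sum.inl '' A)) :
    ∃ a ∈ A, ∃ b ∈ A, ∃ s, IsGeodesicSegment s a b ∧ x ∈ s := by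
  rcases hx with ⟨a, hA, rfl⟩ | ⟨_, ⟨a, ha, rfl⟩, _, ⟨b, hb, rfl⟩, -, s, hs, hx⟩
  · have : x ∈ A := by
      have : Sum.inl x ∈ (Sum.inl '' A : Set (X ⊕ Boundary X)) := by rw [hA]; rfl
      obtain ⟨y, hy, he⟩ := this
      rwa [← Sum.inl_injective he]
    obtain ⟨s, hs⟩ := H x x
    exact ⟨x, this, x, this, s, hs, seg_left hs⟩
  · exact ⟨a, ha, b, hb, s, hs, hx⟩

theorem conv_preconn {A : Set X} (H : GeodesicSpace X) :
    IsPreconnected (geoConv (X := X) (Sum.inl '' A)) := by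
  rcases A.eq_empty_or_nonempty with rfl | ⟨a₀, ha₀⟩
  · have : geoConv (X := X) (Sum.inl '' (∅ : Set X)) = ∅ := by
      ext x
      simp only [Set.mem_empty_iff_false, iff_false]
      intro hx
      obtain ⟨a, ha, -⟩ := conv_elim H hx
      exact ha
    rw [this]; exact isPreconnected_empty
  · refine isPreconnected_of_forall a₀ fun y hy => ?_
    obtain ⟨a, ha, b, hb, s, hs, hys⟩ := conv_elim H hy
    obtain ⟨t, ht⟩ := H a₀ a
    exact ⟨t ∪ s, Set.union_subset (seg_sub_conv H ha₀ ha ht) (seg_sub_conv H ha hb hs),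
      Or.inl (seg_left ht), Or.inr hys,
      (seg_preconn ht).union a (seg_right ht) (seg_left hs) (seg_preconn hs)⟩

theorem conv_qc {δ : ℝ} (H : DeltaHyperbolic δ X) (A : Set X) :
    Quasiconvex (2 * δ) (geoConv (X := X) (Sum.inl '' A)) := by
  intro x hx y hy s hs p hp
  obtain ⟨a, ha, b, hb, t, ht, hxt⟩ := conv_elim H.1 hx
  obtain ⟨c, hc, d, hd, t', ht', hyt⟩ := conv_elim H.1 hy
  obtain ⟨r, hr, hr'⟩ := seg_sub ht hxt
  obtain ⟨r₁, hr₁, hr₁'⟩ := seg_sub ht' hyt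
  obtain ⟨m, hm⟩ := H.1 a c
  rcases quadC H hs (seg_symm hr') hm hr₁' hp with ⟨q, hq, h⟩ | ⟨q, hq, h⟩ | ⟨q, hq, h⟩
  · exact ⟨q, seg_sub_conv H.1 ha hb ht (hr hq), h⟩
  · exact ⟨q, seg_sub_conv H.1 ha hc hm hq, h⟩
  · exact ⟨q, seg_sub_conv H.1 hc hd ht' (hr₁ hq), h⟩

theorem closure_qc {δ : ℝ} (hδ : 0 < δ) (H : DeltaHyperbolic δ X) {A : Set X}
    (hA : Quasiconvex (2 * δ) A) : Quasiconvex (4 * δ) (closure A) := by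
  intro x hx y hy s hs p hp
  obtain ⟨x', hx', hxx⟩ := Metric.mem_closure_iff.1 hx δ hδ
  obtain ⟨y', hy', hyy⟩ := Metric.mem_closure_iff.1 hy δ hδ
  obtain ⟨s₁, h₁⟩ := H.1 x x'
  obtain ⟨s₂, h₂⟩ := H.1 x' y'
  obtain ⟨s₃, h₃⟩ := H.1 y' y
  rcases quadC H hs h₁ h₂ h₃ hp with ⟨q, hq, h⟩ | ⟨q, hq, h⟩ | ⟨q, hq, h⟩
  · refine ⟨x, hx, ?_⟩
    have := seg_dist h₁ hq
    have := dist_triangle p q x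
    rw [dist_comm q x] at this
    linarith [dist_nonneg (x := q) (y := x')]
  · obtain ⟨a, ha, hqa⟩ := hA x' hx' y' hy' s₂ h₂ q hq
    exact ⟨a, subset_closure ha, by linarith [dist_triangle p q a]⟩
  · refine ⟨y, hy, ?_⟩
    have := seg_dist h₃ hq
    have := dist_triangle p q y
    rw [dist_comm y' y] at *
    linarith [dist_nonneg (x := y') (y := q)]

/-! ### Rays -/

theorem ray_seg {γ : ℝ → X} (h : IsGeodesicRay γ) {a b : ℝ} (ha : 0 ≤ a) (hab : a ≤ b) :
    IsGeodesicSegment (γ '' Set.Icc a b) (γ a) (γ b) :=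
  seg_of_isom hab fun u hu v hv => h u v (ha.trans hu.1) (ha.trans hv.1)

theorem ray_seg_sub {γ : ℝ → X} {b : ℝ} : γ '' Set.Icc 0 b ⊆ γ '' Set.Ici 0 :=
  Set.image_mono fun _ h => h.1

theorem bi_ray {γ : ℝ → X} (h : IsBiGeodesic γ) (a : ℝ) : IsGeodesicRay fun t => γ (a + t) := by
  intro s t _ _
  rw [h]; congr 1; ring

theorem bi_ray_neg {γ : ℝ → X} (h : IsBiGeodesic γ) (a : ℝ) :
    IsGeodesicRay fun t => γ (a - t) := by
  intro s t _ _
  rw [h, abs_sub_comm]; congr 1; ring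

/-- A half of the asymptoticity criterion. -/
theorem half_asymp {δ : ℝ} (H : DeltaHyperbolic δ X) {γ ρ : ℝ → X}
    (hγ : IsGeodesicRay γ) (hρ : IsGeodesicRay ρ) {C : ℝ} (hC : 2 * δ ≤ C)
    (h : ∀ t : ℝ, 0 ≤ t → ∃ n m : ℝ, t ≤ n ∧ 0 ≤ m ∧ ∃ s, IsGeodesicSegment s (γ n) (ρ m) ∧
      ∀ q ∈ s, dist (γ t) q ≤ 2 * δ → ∃ b ∈ ρ '' Set.Ici 0, dist (γ t) b ≤ C) :
    ∀ a ∈ γ '' Set.Ici 0, ∃ b ∈ ρ '' Set.Ici 0, dist a b ≤ C + dist (γ 0) (ρ 0) := by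
  rintro _ ⟨t, ht, rfl⟩
  obtain ⟨n, m, htn, hm, s, hs, hq⟩ := h t ht
  obtain ⟨r, hr⟩ := H.1 (γ 0) (ρ 0)
  have hn : 0 ≤ n := le_trans ht htn
  have hd := dist_nonneg (x := γ 0) (y := ρ 0)
  rcases quadC H (ray_seg hγ le_rfl hn) hr (ray_seg hρ le_rfl hm) (seg_symm hs)
    ⟨t, ⟨ht, htn⟩, rfl⟩ with ⟨q, hq', h⟩ | ⟨q, hq', h⟩ | ⟨q, hq', h⟩
  · refine ⟨ρ 0, ⟨0, Set.mem_Ici.2 le_rfl, rfl⟩, ?_⟩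
    have := seg_dist hr hq'
    linarith [dist_triangle (γ t) q (ρ 0), dist_nonneg (x := γ 0) (y := q)]
  · exact ⟨q, ray_seg_sub hq', by linarith⟩
  · obtain ⟨b, hb, hb'⟩ := hq q hq' h
    exact ⟨b, hb, by linarith⟩

theorem asymp_of_half {γ ρ : ℝ → X} {C C' : ℝ}
    (h : ∀ a ∈ γ '' Set.Ici 0, ∃ b ∈ ρ '' Set.Ici 0, dist a b ≤ C)
    (h' : ∀ a ∈ ρ '' Set.Ici 0, ∃ b ∈ γ '' Set.Ici 0, dist a b ≤ C') : Asymptotic γ ρ := by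
  refine ⟨max C C', fun a ha => ?_, fun b hb => ?_⟩
  · obtain ⟨b, hb, hd⟩ := h a ha
    exact ⟨b, hb, hd.trans (le_max_left _ _)⟩
  · obtain ⟨a, ha, hd⟩ := h' b hb
    exact ⟨a, ha, by rw [dist_comm]; exact hd.trans (le_max_right _ _)⟩

theorem gromov_comm (x y z : X) : gromov x y z = gromov x z y := by
  unfold gromov; rw [dist_comm y z]; ring

theorem gromov_le {x y z w : X} {s : Set X} (hs : IsGeodesicSegment s y z) (hw : w ∈ s) :
    gromov x y z ≤ dist x w := by
  unfold gromov
  have := seg_dist hs hw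
  have := dist_triangle y w x
  have := dist_triangle z w x
  rw [dist_comm w x] at *
  rw [dist_comm z w] at *
  linarith

theorem half_of_gromov {δ : ℝ} (H : DeltaHyperbolic δ X) {γ ρ : ℝ → X} {x : X}
    (hγ : IsGeodesicRay γ) (hρ : IsGeodesicRay ρ)
    (h : ∀ M : ℝ, ∃ N : ℕ, ∀ n, N ≤ n → ∀ m, N ≤ m → M ≤ gromov x (γ (n : ℕ)) (ρ (m : ℕ))) :
    ∀ a ∈ γ '' Set.Ici 0, ∃ b ∈ ρ '' Set.Ici 0, dist a b ≤ 2 * δ + dist (γ 0) (ρ 0) := by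
  refine half_asymp H hγ hρ le_rfl fun t ht => ?_
  obtain ⟨N, hN⟩ := h (dist x (γ t) + 2 * δ + 1)
  obtain ⟨k, hk⟩ := exists_nat_ge t
  obtain ⟨s, hs⟩ := H.1 (γ ((max N k : ℕ) : ℝ)) (ρ ((max N k : ℕ) : ℝ))
  refine ⟨(max N k : ℕ), (max N k : ℕ), hk.trans (by exact_mod_cast le_max_right _ _),
    Nat.cast_nonneg _, s, hs, fun q hq hd => ?_⟩
  exfalso
  have h1 := hN (max N k) (le_max_left _ _) (max N k) (le_max_left _ _)
  have h2 := gromov_le (x := x) hs hq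
  linarith [dist_triangle x (γ t) q]

theorem asymp_of_gromov {δ : ℝ} (H : DeltaHyperbolic δ X) {γ ρ : ℝ → X} {x : X}
    (hγ : IsGeodesicRay γ) (hρ : IsGeodesicRay ρ)
    (h : ∀ M : ℝ, ∃ N : ℕ, ∀ n, N ≤ n → ∀ m, N ≤ m → M ≤ gromov x (γ (n : ℕ)) (ρ (m : ℕ))) :
    Asymptotic γ ρ := by
  refine asymp_of_half (half_of_gromov H hγ hρ h) (half_of_gromov (x := x) H hρ hγ fun M => ?_)
  obtain ⟨N, hN⟩ := h M
  exact ⟨N, fun n hn m hm => by rw [gromov_comm]; exact hN m hm n hn⟩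

theorem half_of_close {δ : ℝ} (hδ : 0 < δ) (H : DeltaHyperbolic δ X) {γ ρ : ℝ → X} {K : ℝ}
    (hγ : IsGeodesicRay γ) (hρ : IsGeodesicRay ρ)
    (h : ∀ T : ℝ, ∃ n m : ℝ, T ≤ n ∧ 0 ≤ m ∧ dist (γ n) (ρ m) ≤ K) :
    ∀ a ∈ γ '' Set.Ici 0, ∃ b ∈ ρ '' Set.Ici 0, dist a b ≤ (2 * δ + K) + dist (γ 0) (ρ 0) := by
  have hK : 0 ≤ K := by
    obtain ⟨n, m, -, -, h⟩ := h 0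
    exact dist_nonneg.trans h
  refine half_asymp H hγ hρ (by linarith) fun t ht => ?_
  obtain ⟨n, m, hn, hm, hd⟩ := h t
  obtain ⟨s, hs⟩ := H.1 (γ n) (ρ m)
  refine ⟨n, m, hn, hm, s, hs, fun q hq hq' => ⟨ρ m, ⟨m, hm, rfl⟩, ?_⟩⟩
  have := seg_dist hs hq
  linarith [dist_triangle (γ t) q (ρ m), dist_nonneg (x := γ n) (y := q)]

theorem asymp_of_close {δ : ℝ} (hδ : 0 < δ) (H : DeltaHyperbolic δ X) {γ ρ : ℝ → X} {K : ℝ}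
    (hγ : IsGeodesicRay γ) (hρ : IsGeodesicRay ρ)
    (h : ∀ T : ℝ, ∃ n m : ℝ, T ≤ n ∧ 0 ≤ m ∧ dist (γ n) (ρ m) ≤ K) : Asymptotic γ ρ := by
  refine asymp_of_half (half_of_close hδ H hγ hρ h) (half_of_close hδ H hρ hγ (K := K) fun T => ?_)
  obtain ⟨n, m, hn, hm, hd⟩ := h (max 0 (T + K + dist (γ 0) (ρ 0)))
  have hn0 : 0 ≤ n := (le_max_left _ _).trans hn
  refine ⟨m, n, ?_, hn0, by rwa [dist_comm]⟩
  have h1 := hγ 0 n le_rfl hn0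
  have h2 := hρ 0 m le_rfl hm
  rw [abs_of_nonpos (by linarith)] at h1 h2
  have h3 : T + K + dist (γ 0) (ρ 0) ≤ n := (le_max_right _ _).trans hn
  have := dist_triangle (γ 0) (ρ 0) (γ n)
  have := dist_triangle (ρ 0) (ρ m) (γ n)
  rw [dist_comm (ρ m)] at this
  linarith

theorem asymp_close {γ ρ : ℝ → X} (h : Asymptotic γ ρ) :
    ∃ K : ℝ, ∀ t, 0 ≤ t → ∃ m, 0 ≤ m ∧ dist (γ t) (ρ m) ≤ K := by
  obtain ⟨K, h, -⟩ := h
  refine ⟨K, fun t ht => ?_⟩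
  obtain ⟨_, ⟨m, hm, rfl⟩, hd⟩ := h _ ⟨t, ht, rfl⟩
  exact ⟨m, hm, hd⟩

theorem mk_eq_iff {γ ρ : ℝ → X} (hγ : IsGeodesicRay γ) (hρ : IsGeodesicRay ρ) :
    Boundary.mk ⟨γ, hγ⟩ = Boundary.mk ⟨ρ, hρ⟩ ↔ Asymptotic γ ρ :=
  ⟨fun h => Quotient.exact h, fun h => Quotient.sound h⟩

theorem asymp_shift {γ : ℝ → X} (h : IsGeodesicRay γ) {ρ : ℝ → X} {c : ℝ}
    (hρ : ∀ t, 0 ≤ t → ∃ m, 0 ≤ m ∧ dist (γ t) (ρ m) ≤ c)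
    (hρ' : ∀ t, 0 ≤ t → ∃ m, 0 ≤ m ∧ dist (ρ t) (γ m) ≤ c) : Asymptotic γ ρ := by
  refine asymp_of_half (C := c) (C' := c) ?_ ?_
  · rintro _ ⟨t, ht, rfl⟩
    obtain ⟨m, hm, hd⟩ := hρ t ht
    exact ⟨_, ⟨m, hm, rfl⟩, hd⟩
  · rintro _ ⟨t, ht, rfl⟩
    obtain ⟨m, hm, hd⟩ := hρ' t ht
    exact ⟨_, ⟨m, hm, rfl⟩, hd⟩

theorem bi_rev {γ : ℝ → X} {p q : Boundary X} (h : BiGeodesicJoins γ p q) :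
    BiGeodesicJoins (fun t => γ (-t)) q p := by
  obtain ⟨h1, h2, h3⟩ := h
  refine ⟨fun s t => ?_, by simpa using h3, by simpa using h2⟩
  rw [h1, abs_sub_comm]; congr 1; ring

/-- A biinfinite geodesic with end `q` gives a ray from each of its points to `q`. -/
theorem bi_rayTo {δ : ℝ} (H : DeltaHyperbolic δ X) {γ : ℝ → X} {p q : Boundary X}
    (h : BiGeodesicJoins γ p q) (a : ℝ) : RayTo (fun t => γ (a + t)) q := by
  obtain ⟨h1, -, ⟨ρ, hρ, h3⟩⟩ := h
  refine ⟨bi_ray h1 a, ?_⟩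
  have e0 := bi_ray h1 0
  have e1 : Asymptotic (fun t => γ (0 + t)) ρ.1 :=
    asymp_of_gromov (x := γ 0) H e0 ρ.2 (by simpa using h3)
  have e2 : Asymptotic (fun t => γ (a + t)) (fun t => γ (0 + t)) := by
    refine asymp_shift (c := |a|) (bi_ray h1 a) (fun t ht => ⟨t, ht, ?_⟩) (fun t ht => ⟨t, ht, ?_⟩)
    · rw [h1]; simp
    · rw [h1]; simp
  rw [← hρ]
  exact (mk_eq_iff (bi_ray h1 a) ρ.2).2 (asymptotic_trans e2 e1)

theorem bi_conv {γ : ℝ → X} (h : IsGeodesicRay γ) :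
    SeqConvTo (γ 0) (fun n => γ (n : ℝ)) (Boundary.mk ⟨γ, h⟩) := by
  refine ⟨⟨γ, h⟩, rfl, fun M => ?_⟩
  obtain ⟨N, hN⟩ := exists_nat_ge M
  refine ⟨N, fun n hn m hm => hN.trans ?_⟩
  unfold gromov
  have a1 : (0:ℝ) ≤ n := Nat.cast_nonneg _
  have a2 : (0:ℝ) ≤ m := Nat.cast_nonneg _
  have b1 : (N:ℝ) ≤ n := by exact_mod_cast hn
  have b2 : (N:ℝ) ≤ m := by exact_mod_cast hm
  change (N:ℝ) ≤ (dist (γ n) (γ 0) + dist (γ m) (γ 0) - dist (γ n) (γ m)) / 2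
  rw [h n 0 a1 le_rfl, h m 0 a2 le_rfl, h n m a1 a2, sub_zero, sub_zero, abs_of_nonneg a1,
    abs_of_nonneg a2]
  rcases abs_cases ((n:ℝ) - m) with ⟨e, -⟩ | ⟨e, -⟩ <;> rw [e] <;> linarith

/-- A ray whose points are close to the union of two rays is asymptotic to one of them. -/
theorem asymp_or {δ : ℝ} (hδ : 0 < δ) (H : DeltaHyperbolic δ X) {γ ρ₁ ρ₂ : ℝ → X} {K : ℝ}
    (hγ : IsGeodesicRay γ) (h₁ : IsGeodesicRay ρ₁) (h₂ : IsGeodesicRay ρ₂)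
    (h : ∀ t, 0 ≤ t → ∃ b ∈ ρ₁ '' Set.Ici 0 ∪ ρ₂ '' Set.Ici 0, dist (γ t) b ≤ K) :
    Asymptotic γ ρ₁ ∨ Asymptotic γ ρ₂ := by
  by_contra hcon
  push Not at hcon
  obtain ⟨c1, c2⟩ := hcon
  have d1 : ∃ T : ℝ, ∀ n m : ℝ, T ≤ n → 0 ≤ m → K < dist (γ n) (ρ₁ m) := by
    by_contra hh
    push Not at hh
    exact c1 (asymp_of_close hδ H hγ h₁ hh)
  have d2 : ∃ T : ℝ, ∀ n m : ℝ, T ≤ n → 0 ≤ m → K < dist (γ n) (ρ₂ m) := by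
    by_contra hh
    push Not at hh
    exact c2 (asymp_of_close hδ H hγ h₂ hh)
  obtain ⟨T₁, hT₁⟩ := d1
  obtain ⟨T₂, hT₂⟩ := d2
  obtain ⟨b, hb, hd⟩ := h (max 0 (max T₁ T₂)) (le_max_left _ _)
  rcases hb with ⟨m, hm, rfl⟩ | ⟨m, hm, rfl⟩
  · exact absurd hd (not_le.2 (hT₁ _ m ((le_max_left _ _).trans (le_max_right _ _)) hm))
  · exact absurd hd (not_le.2 (hT₂ _ m ((le_max_right _ _).trans (le_max_right _ _)) hm))

/-- The two ends of a biinfinite geodesic are not asymptotic. -/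
theorem bi_not_asymp {γ : ℝ → X} (h : IsBiGeodesic γ) :
    ¬ Asymptotic (fun t => γ (0 + t)) (fun t => γ (0 - t)) := by
  intro hh
  obtain ⟨K, hK⟩ := asymp_close hh
  obtain ⟨m, hm, hd⟩ := hK (|K| + 1) (by positivity)
  rw [h, abs_of_nonneg (by linarith [abs_nonneg K])] at hd
  linarith [le_abs_self K]

theorem exists_bi {δ : ℝ} (hδ : 0 < δ) (H : DeltaHyperbolic δ X) (hsg : StronglyGeodesic X)
    {p q : Boundary X} (hpq : p ≠ q) : ∃ γ : ℝ → X, BiGeodesicJoins γ p q := by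
  induction p using Quotient.inductionOn with | _ γ₁
  induction q using Quotient.inductionOn with | _ γ₂
  obtain ⟨γ₁, h₁⟩ := γ₁
  obtain ⟨γ₂, h₂⟩ := γ₂
  change Boundary.mk ⟨γ₁, h₁⟩ ≠ Boundary.mk ⟨γ₂, h₂⟩ at hpq
  change ∃ γ : ℝ → X, BiGeodesicJoins γ (Boundary.mk ⟨γ₁, h₁⟩) (Boundary.mk ⟨γ₂, h₂⟩)
  obtain ⟨γ₃, h₃, h30, h13⟩ := hsg.2.1 γ₂ h₂ (γ₁ 0)
  have hna : ¬ Asymptotic γ₁ γ₃ := fun h =>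
    hpq ((mk_eq_iff h₁ h₂).2 (asymptotic_trans h (asymptotic_symm h13)))
  obtain ⟨γ, hγ, K, hK, -⟩ := hsg.2.2.1 γ₁ γ₃ h₁ h₃ h30.symm hna
  have hp := bi_ray hγ 0
  have hm := bi_ray_neg hγ 0
  have key : ∀ {α β : ℝ → X} (hα : IsGeodesicRay α) (hβ : IsGeodesicRay β),
      Asymptotic (fun t => γ (0 - t)) α → Asymptotic (fun t => γ (0 + t)) β →
      BiGeodesicJoins γ (Boundary.mk ⟨α, hα⟩) (Boundary.mk ⟨β, hβ⟩) := by
    intro α β hα hβ ha hb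
    refine ⟨hγ, ?_, ?_⟩
    · rw [← (mk_eq_iff hm hα).2 ha]
      simpa using bi_conv hm
    · rw [← (mk_eq_iff hp hβ).2 hb]
      simpa using bi_conv hp
  have hn := bi_not_asymp hγ
  have e2 : Boundary.mk ⟨γ₂, h₂⟩ = Boundary.mk ⟨γ₃, h₃⟩ := (mk_eq_iff h₂ h₃).2 h13
  rw [e2]
  rcases asymp_or hδ H hp h₁ h₃ (fun t _ => hK _ ⟨_, rfl⟩) with a | a <;>
  rcases asymp_or hδ H hm h₁ h₃ (fun t _ => hK _ ⟨_, rfl⟩) with b | b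
  · exact absurd (asymptotic_trans a (asymptotic_symm b)) hn
  · exact ⟨_, bi_rev (key h₃ h₁ b a)⟩
  · exact ⟨γ, key h₁ h₃ b a⟩
  · exact absurd (asymptotic_trans a (asymptotic_symm b)) hn

theorem rayTo_asymp {γ ρ : ℝ → X} {p : Boundary X} (h : RayTo γ p) (h' : RayTo ρ p) :
    Asymptotic γ ρ := by
  obtain ⟨h1, e1⟩ := h
  obtain ⟨h2, e2⟩ := h'
  exact (mk_eq_iff h1 h2).1 (e1.trans e2.symm)

theorem far_side {w q z x : X} {t : Set X} {K T D : ℝ} (ht : IsGeodesicSegment t w q)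
    (hz : z ∈ t) (hd : dist w q ≤ K) (hx : T ≤ dist x w) (hD : D < T - K) : D < dist x z := by
  have := seg_dist ht hz
  have := dist_triangle x z w
  rw [dist_comm z w] at this
  linarith [dist_nonneg (x := z) (y := q)]

theorem weak_qc {δ : ℝ} (hδ : 0 < δ) (H : DeltaHyperbolic δ X) (hsg : StronglyGeodesic X)
    (L : Set (Boundary X)) : Quasiconvex (8 * δ) (geoConv (X := X) (Sum.inr '' L)) := by
  have elim : ∀ x ∈ geoConv (X := X) (Sum.inr '' L), ∃ p ∈ L, ∃ α : ℝ → X, RayTo α p ∧ α 0 = x ∧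
      α '' Set.Ici 0 ⊆ geoConv (X := X) (Sum.inr '' L) := by
    intro x hx
    rcases hx with ⟨a, hA, rfl⟩ | ⟨_, ⟨p, hp, rfl⟩, _, ⟨q, hq, rfl⟩, hne, s, ⟨γ, hγ, rfl⟩, hx⟩
    · exfalso
      have : Sum.inl x ∈ (Sum.inr '' L : Set (X ⊕ Boundary X)) := by rw [hA]; rfl
      obtain ⟨y, -, he⟩ := this
      cases he
    · obtain ⟨t, rfl⟩ := hx
      refine ⟨q, hq, fun τ => γ (t + τ), bi_rayTo H hγ t, by simp, ?_⟩
      rintro _ ⟨τ, -, rfl⟩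
      exact Or.inr ⟨_, ⟨p, hp, rfl⟩, _, ⟨q, hq, rfl⟩, hne, _, ⟨γ, hγ, rfl⟩, ⟨_, rfl⟩⟩
  intro x hx y hy s hs z hz
  obtain ⟨p, hp, α, hα, rfl, hαs⟩ := elim x hx
  obtain ⟨q, hq, β, hβ, rfl, hβs⟩ := elim y hy
  obtain ⟨hαr, -⟩ := id hα
  obtain ⟨hβr, -⟩ := id hβ
  have hxz := dist_nonneg (x := α 0) (y := z)
  have hyz := dist_nonneg (x := β 0) (y := z)
  by_cases hpq : p = q
  · subst hpq
    obtain ⟨K, hK⟩ := asymp_close (rayTo_asymp hα hβ)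
    have hK0 : 0 ≤ K := by
      obtain ⟨m, -, hd⟩ := hK 0 le_rfl
      exact dist_nonneg.trans hd
    set T := dist (α 0) z + 2 * δ + K + 1 with hT
    have hT0 : 0 ≤ T := by linarith
    obtain ⟨m, hm, hd⟩ := hK T hT0
    obtain ⟨t, ht⟩ := H.1 (α T) (β m)
    have hαT : T ≤ dist (α 0) (α T) := by
      rw [hαr 0 T le_rfl hT0, abs_of_nonpos (by linarith)]; linarith
    rcases quadC H hs (ray_seg hαr le_rfl hT0) ht (seg_symm (ray_seg hβr le_rfl hm)) hz with
      ⟨r, hr, h⟩ | ⟨r, hr, h⟩ | ⟨r, hr, h⟩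
    · exact ⟨r, hαs (ray_seg_sub hr), by linarith⟩
    · exfalso
      have := far_side (D := dist (α 0) z + 2 * δ) ht hr hd hαT (by linarith)
      linarith [dist_triangle (α 0) z r]
    · exact ⟨r, hβs (ray_seg_sub hr), by linarith⟩
  · obtain ⟨η, hη⟩ := exists_bi hδ H hsg hpq
    have hηs : Set.range η ⊆ geoConv (X := X) (Sum.inr '' L) := by
      intro r hr
      exact Or.inr ⟨_, ⟨p, hp, rfl⟩, _, ⟨q, hq, rfl⟩, fun h => hpq (Sum.inr_injective h), _,
        ⟨η, hη, rfl⟩, hr⟩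
    have r1 := bi_rayTo H hη 0
    have r2 := bi_rayTo H (bi_rev hη) 0
    obtain ⟨K, hK⟩ := asymp_close (rayTo_asymp hα r2)
    obtain ⟨K', hK'⟩ := asymp_close (rayTo_asymp hβ r1)
    have hK0 : 0 ≤ K := by
      obtain ⟨m, -, hd⟩ := hK 0 le_rfl
      exact dist_nonneg.trans hd
    have hK0' : 0 ≤ K' := by
      obtain ⟨m, -, hd⟩ := hK' 0 le_rfl
      exact dist_nonneg.trans hd
    set T := dist (α 0) z + 4 * δ + K + 1 with hT
    set T' := dist (β 0) z + 4 * δ + K' + 1 with hT'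
    have hT0 : 0 ≤ T := by linarith
    have hT0' : 0 ≤ T' := by linarith
    obtain ⟨m, hm, hd⟩ := hK T hT0
    obtain ⟨m', hm', hd'⟩ := hK' T' hT0'
    simp only [zero_add] at hd hd'
    obtain ⟨t, ht⟩ := H.1 (α T) (η (-m))
    obtain ⟨t', ht'⟩ := H.1 (β T') (η m')
    obtain ⟨c, hc⟩ := H.1 (α T) (β T')
    have hmid : IsGeodesicSegment (η '' Set.Icc (-m) m') (η (-m)) (η m') :=
      seg_of_isom (by linarith) fun u _ v _ => hη.1 u v
    have hαT : T ≤ dist (α 0) (α T) := by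
      rw [hαr 0 T le_rfl hT0, abs_of_nonpos (by linarith)]; linarith
    have hβT : T' ≤ dist (β 0) (β T') := by
      rw [hβr 0 T' le_rfl hT0', abs_of_nonpos (by linarith)]; linarith
    rcases quadC H hs (ray_seg hαr le_rfl hT0) hc (seg_symm (ray_seg hβr le_rfl hT0')) hz with
      ⟨r, hr, h⟩ | ⟨r, hr, h⟩ | ⟨r, hr, h⟩
    · exact ⟨r, hαs (ray_seg_sub hr), by linarith⟩
    · rcases quadC H hc ht hmid (seg_symm ht') hr with
        ⟨r', hr', h'⟩ | ⟨r', hr', h'⟩ | ⟨r', hr', h'⟩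
      · exfalso
        have := far_side (D := dist (α 0) z + 4 * δ) ht hr' hd hαT (by linarith)
        linarith [dist_triangle (α 0) z r', dist_triangle z r r']
      · refine ⟨r', hηs ?_, by linarith [dist_triangle z r r']⟩
        obtain ⟨w, -, rfl⟩ := hr'
        exact ⟨w, rfl⟩
      · exfalso
        have := far_side (D := dist (β 0) z + 4 * δ) ht' hr' hd' hβT (by linarith)
        linarith [dist_triangle (β 0) z r', dist_triangle z r r']
    · exact ⟨r, hβs (ray_seg_sub hr), by linarith⟩

/-! ### Group actions -/

variable {G : Type u} [Group G] [MulAction G X]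

theorem ray_smul (hiso : IsometricAction G X) (g : G) {γ : ℝ → X} (h : IsGeodesicRay γ) :
    IsGeodesicRay fun t => g • γ t := fun s t hs ht => by rw [hiso, h s t hs ht]

theorem asymp_smul (hiso : IsometricAction G X) (g : G) {γ ρ : ℝ → X} (h : Asymptotic γ ρ) :
    Asymptotic (fun t => g • γ t) (fun t => g • ρ t) := by
  obtain ⟨K, h1, h2⟩ := h
  refine ⟨K, ?_, ?_⟩
  · rintro _ ⟨t, ht, rfl⟩
    obtain ⟨_, ⟨m, hm, rfl⟩, hd⟩ := h1 _ ⟨t, ht, rfl⟩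
    exact ⟨_, ⟨m, hm, rfl⟩, (hiso g _ _).le.trans hd⟩
  · rintro _ ⟨t, ht, rfl⟩
    obtain ⟨_, ⟨m, hm, rfl⟩, hd⟩ := h2 _ ⟨t, ht, rfl⟩
    exact ⟨_, ⟨m, hm, rfl⟩, (hiso g _ _).le.trans hd⟩

/-- The induced map on the boundary. -/
def bsm (hiso : IsometricAction G X) (g : G) : Boundary X → Boundary X :=
  Quotient.map (sa := raySetoid X) (sb := raySetoid X)
    (fun γ : GRay X => (⟨fun t => g • γ.1 t, ray_smul hiso g γ.2⟩ : GRay X))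
    (fun _ _ h => asymp_smul hiso g h)

theorem bsm_mk (hiso : IsometricAction G X) (g : G) (γ : GRay X) :
    bsm hiso g (Boundary.mk γ) = Boundary.mk ⟨fun t => g • γ.1 t, ray_smul hiso g γ.2⟩ := rfl

theorem bsm_inv (hiso : IsometricAction G X) (g : G) (p : Boundary X) :
    bsm hiso g⁻¹ (bsm hiso g p) = p := by
  induction p using Quotient.inductionOn with | _ γ
  change bsm hiso g⁻¹ (bsm hiso g (Boundary.mk γ)) = Boundary.mk γ
  obtain ⟨γ, hγ⟩ := γ
  refine (mk_eq_iff (ray_smul hiso g⁻¹ (ray_smul hiso g hγ)) hγ).2 ?_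
  simp only [inv_smul_smul]
  exact asymptotic_refl γ

/-- The induced map on `X ∪ ∂X`. -/
def xsm (hiso : IsometricAction G X) (g : G) : X ⊕ Boundary X → X ⊕ Boundary X :=
  Sum.map (fun x => g • x) (bsm hiso g)

theorem xsm_inj (hiso : IsometricAction G X) (g : G) : Function.Injective (xsm hiso g) := by
  apply Sum.map_injective.2
  exact ⟨MulAction.injective g, Function.LeftInverse.injective (bsm_inv hiso g)⟩

theorem seg_smul (hiso : IsometricAction G X) (g : G) {s : Set X} {x y : X}
    (h : IsGeodesicSegment s x y) : IsGeodesicSegment ((fun x => g • x) '' s) (g • x) (g • y) := by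
  obtain ⟨b, f, hb, h0, h1, hf, rfl⟩ := h
  refine ⟨b, fun t => g • f t, hb, by simp only [h0], by simp only [h1], ?_, ?_⟩
  · intro u hu v hv
    rw [hiso, hf u hu v hv]
  · rw [Set.image_image]

theorem conv_smul (hiso : IsometricAction G X) (g : G) {x : X} {w : ℕ → X} {p : Boundary X}
    (h : SeqConvTo x w p) : SeqConvTo (g • x) (fun n => g • w n) (bsm hiso g p) := by
  obtain ⟨γ, rfl, h⟩ := h
  refine ⟨⟨fun t => g • γ.1 t, ray_smul hiso g γ.2⟩, rfl, ?_⟩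
  intro M
  obtain ⟨N, hN⟩ := h M
  refine ⟨N, fun n hn m hm => ?_⟩
  have := hN n hn m hm
  unfold gromov at *
  simpa only [hiso g] using this

theorem rayTo_smul (hiso : IsometricAction G X) (g : G) {γ : ℝ → X} {p : Boundary X}
    (h : RayTo γ p) : RayTo (fun t => g • γ t) (bsm hiso g p) := by
  obtain ⟨h, rfl⟩ := h
  exact ⟨ray_smul hiso g h, rfl⟩

theorem join_smul (hiso : IsometricAction G X) (g : G) {p q : X ⊕ Boundary X} {s : Set X}
    (h : JoinSet p q s) : JoinSet (xsm hiso g p) (xsm hiso g q) ((fun x => g • x) '' s) := by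
  rcases p with x | p <;> rcases q with y | q
  · exact seg_smul hiso g h
  · obtain ⟨γ, rfl, h, rfl⟩ := h
    exact ⟨fun t => g • γ t, rfl, rayTo_smul hiso g h, by rw [Set.image_image]⟩
  · obtain ⟨γ, rfl, h, rfl⟩ := h
    exact ⟨fun t => g • γ t, rfl, rayTo_smul hiso g h, by rw [Set.image_image]⟩
  · obtain ⟨γ, ⟨h1, h2, h3⟩, rfl⟩ := h
    refine ⟨fun t => g • γ t, ⟨fun s t => by rw [hiso, h1], conv_smul hiso g h2,
      conv_smul hiso g h3⟩, ?_⟩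
    rw [← Set.range_comp]; rfl

theorem geoConv_smul (hiso : IsometricAction G X) (g : G) {A : Set (X ⊕ Boundary X)}
    (hA : ∀ a ∈ A, xsm hiso g a ∈ A) : ∀ x ∈ geoConv A, g • x ∈ geoConv A := by
  rintro x (⟨a, rfl, rfl⟩ | ⟨p, hp, q, hq, hne, s, hs, hx⟩)
  · have : xsm hiso g (Sum.inl x) = Sum.inl x := hA (Sum.inl x) rfl
    have h2 : g • x = x := Sum.inl_injective this
    exact Or.inl ⟨x, rfl, h2⟩
  · exact Or.inr ⟨_, hA p hp, _, hA q hq, fun h => hne (xsm_inj hiso g h), _,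
      join_smul hiso g hs, ⟨x, hx, rfl⟩⟩

theorem smul_eq_of {U : Subgroup G} {A : Set X} (h : ∀ g ∈ U, ∀ x ∈ A, g • x ∈ A) :
    ∀ g : G, g ∈ U → g • A = A := by
  intro g hg
  ext x
  rw [Set.mem_smul_set_iff_inv_smul_mem]
  constructor
  · intro hx
    simpa using h g hg _ hx
  · intro hx
    exact h _ (U.inv_mem hg) _ hx

theorem limit_smul (hiso : IsometricAction G X) {U : Subgroup G} {g : G} (hg : g ∈ U) :
    ∀ p ∈ limitSet X U, bsm hiso g p ∈ limitSet X U := by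
  rintro p ⟨x₀, w, h⟩
  refine ⟨g • x₀, fun n => ⟨g, hg⟩ * w n * ⟨g, hg⟩⁻¹, ?_⟩
  have := conv_smul hiso g h
  simpa [mul_smul] using this

theorem disp_smul (hiso : IsometricAction G X) {δ : ℝ} {U : Subgroup G} {g : G} (hg : g ∈ U) :
    ∀ x ∈ smallDispSet X δ U, g • x ∈ smallDispSet X δ U := by
  rintro x ⟨w, hw, hw1, hd⟩
  refine ⟨g * w * g⁻¹, U.mul_mem (U.mul_mem hg hw) (U.inv_mem hg), ?_, ?_⟩
  · intro h
    apply hw1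
    have := mul_inv_eq_one.1 h
    simpa using this
  · simpa [mul_smul, hiso g] using hd

theorem Z_smul (hiso : IsometricAction G X) {δ : ℝ} {U : Subgroup G} {g : G} (hg : g ∈ U) :
    ∀ x ∈ ZSet X δ U, g • x ∈ ZSet X δ U := by
  apply geoConv_smul hiso
  rintro _ (⟨p, hp, rfl⟩ | ⟨x, hx, rfl⟩)
  · exact Or.inl ⟨_, limit_smul hiso hg p hp, rfl⟩
  · exact Or.inr ⟨_, disp_smul hiso hg x hx, rfl⟩

theorem hull_smul (hiso : IsometricAction G X) {δ : ℝ} {U : Subgroup G} {g : G} (hg : g ∈ U) :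
    ∀ x ∈ cHull X δ U, g • x ∈ cHull X δ U := by
  intro x hx
  have hc : Continuous fun x : X => g • x := (Isometry.of_dist_eq (hiso g)).continuous
  refine map_mem_closure hc hx ?_
  apply geoConv_smul hiso
  rintro _ ⟨x, hx, rfl⟩
  exact ⟨_, Z_smul hiso hg x hx, rfl⟩

theorem weak_smul (hiso : IsometricAction G X) {U : Subgroup G} {g : G} (hg : g ∈ U) :
    ∀ x ∈ weakHull X U, g • x ∈ weakHull X U := by
  apply geoConv_smul hiso
  rintro _ ⟨p, hp, rfl⟩
  exact ⟨_, limit_smul hiso hg p hp, rfl⟩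

theorem disp_sub_hull (hsg : StronglyGeodesic X) {δ : ℝ} {U : Subgroup G} :
    smallDispSet X δ U ⊆ cHull X δ U := by
  intro e he
  refine subset_closure (mem_conv_self hsg.1 ?_)
  by_cases h1 : ∃ b ∈ smallDispSet X δ U, b ≠ e
  · obtain ⟨b, hb, hne⟩ := h1
    obtain ⟨s, hs⟩ := hsg.1 e b
    exact Or.inr ⟨Sum.inl e, Or.inr ⟨e, he, rfl⟩, Sum.inl b, Or.inr ⟨b, hb, rfl⟩,
      fun h => hne (Sum.inl_injective h).symm, s, hs, seg_left hs⟩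
  · by_cases h2 : (limitSet X U).Nonempty
    · obtain ⟨p, hp⟩ := h2
      obtain ⟨γ, hγ⟩ : ∃ γ : GRay X, Boundary.mk γ = p := Quotient.exists_rep p
      obtain ⟨γ', h', h0, ha⟩ := hsg.2.1 γ.1 γ.2 e
      refine Or.inr ⟨Sum.inl e, Or.inr ⟨e, he, rfl⟩, Sum.inr p, Or.inl ⟨p, hp, rfl⟩,
        Sum.inl_ne_inr, γ' '' Set.Ici 0, ⟨γ', h0, ⟨h', ?_⟩, rfl⟩, ⟨0, Set.mem_Ici.2 le_rfl, h0⟩⟩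
      rw [← hγ]
      exact (mk_eq_iff h' γ.2).2 (asymptotic_symm ha)
    · refine Or.inl ⟨e, ?_, rfl⟩
      push Not at h1
      have hE : smallDispSet X δ U = {e} := by
        ext x; constructor
        · intro hx; exact h1 x hx
        · rintro rfl; exact he
      rw [Set.not_nonempty_iff_eq_empty.1 h2, hE]
      simp

end Helpers

theorem statement9 {G : Type u} {X : Type v} [Group G] [MetricSpace X] [MulAction G X]
    (δ : ℝ) (hδ : 0 < δ) (hiso : IsometricAction G X) (hsg : StronglyGeodesic X)
    (hhyp : DeltaHyperbolic δ X) (U : Subgroup G) (hU : U ≠ ⊥) :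
    ((∀ u : G, u ∈ U → u • cHull X δ U = cHull X δ U) ∧
     (∀ u : G, u ∈ U → u • smallDispSet X δ U = smallDispSet X δ U) ∧
     (∀ u : G, u ∈ U → u • ZSet X δ U = ZSet X δ U) ∧
     ((∃ p q : Boundary X, p ∈ limitSet X U ∧ q ∈ limitSet X U ∧ p ≠ q) →
        (∀ u : G, u ∈ U → u • weakHull X U = weakHull X U) ∧
        Quasiconvex (8 * δ) (weakHull X U)) ∧
     IsPreconnected (cHull X δ U) ∧ IsClosed (cHull X δ U) ∧
     Quasiconvex (4 * δ) (cHull X δ U)) ∧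
    (∀ (p p' : X) (u : G), u ∈ U → u ≠ 1 →
      IsProjection δ (cHull X δ U) p p' →
      ∀ f₁ f₂ f₃ : ℝ → X,
        GeodParam f₁ (dist p p') p p' →
        GeodParam f₂ (dist p' (u • p')) p' (u • p') →
        GeodParam f₃ (dist (u • p') (u • p)) (u • p') (u • p) →
        QuasigeodesicOn 1 (100 * δ)
          (concat3 f₁ f₂ f₃ (dist p p') (dist p' (u • p'))) 0
          (dist p p' + dist p' (u • p') + dist (u • p') (u • p))) := by
  have hqc : Quasiconvex (4 * δ) (cHull X δ U) := closure_qc hδ hhyp (conv_qc hhyp _)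
  refine ⟨⟨smul_eq_of fun g hg => hull_smul hiso hg, smul_eq_of fun g hg => disp_smul hiso hg,
    smul_eq_of fun g hg => Z_smul hiso hg,
    fun _ => ⟨smul_eq_of fun g hg => weak_smul hiso hg, weak_qc hδ hhyp hsg _⟩,
    (conv_preconn hhyp.1).closure, isClosed_closure, hqc⟩, ?_⟩
  intro p p' u hu hu1 hp f₁ f₂ f₃ h₁ h₂ h₃
  refine concat3_qg h₁ h₂ h₃ ?_
  have e1 : dist (u • p') (u • p) = dist p p' := by rw [hiso, dist_comm]
  by_cases ht : dist p p' ≤ 2 * δ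
  · have := dist_triangle p' p (u • p')
    have := dist_triangle p (u • p) (u • p')
    rw [dist_comm p' p] at *
    rw [dist_comm (u • p) (u • p')] at *
    linarith
  · push Not at ht
    obtain ⟨s, hs⟩ := hhyp.1 p' p
    obtain ⟨x, hx, hxd⟩ := seg_point hs (t := 2 * δ) (by linarith) (by rw [dist_comm]; linarith)
    have hxs := seg_dist hs hx
    have hxu : 100 * δ < dist x (u • x) := by
      by_contra hcon
      push Not at hcon
      have hxE : x ∈ cHull X δ U := disp_sub_hull hsg ⟨u, hu, hu1, hcon⟩
      have := hp.2 x hxE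
      rw [dist_comm x p, dist_comm p' p] at hxs
      linarith
    have hfar : 20 * δ ≤ dist p' (u • p') := by
      have a1 := dist_triangle x p' (u • x)
      have a2 := dist_triangle p' (u • p') (u • x)
      rw [hiso] at a2
      rw [dist_comm x p'] at a1
      linarith
    have hup : IsProjection δ (cHull X δ U) (u • p) (u • p') := by
      refine ⟨hull_smul hiso hu _ hp.1, fun a ha => ?_⟩
      have := hp.2 _ (hull_smul hiso (U.inv_mem hu) a ha)
      have e : dist (u • p) a = dist p (u⁻¹ • a) := by
        rw [← hiso u p (u⁻¹ • a), smul_inv_smul]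
      rw [e, hiso]
      exact this
    have := proj_two hδ hhyp hqc hp hup hfar
    linarith

end KW
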